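/- arXiv:1601.07473 — 9 statements merged into one kernel-verified Lean document; each statement's English description precedes it below -/
import Mathlib

section
/- Let g be a function in 𝒢. Then g is slow-dropping if and only if there exists a sub-polynomial function h : ℕ → ℝ≥0 such that for all positive integers x < y, g(x) ≤ g(y)·h(y). -/
open Filter Real
open scoped ENNReal

noncomputable section

/-- A function `f : ℕ → ℝ≥0` is sub-polynomial if for every `α > 0`,
`x^α * f x → ∞` and `x^(-α) * f x → 0` as `x → ∞`. -/
def SubPoly (f : ℕ → ℝ) : Prop :=
  (∀ x, 0 ≤ f x) ∧
  ∀ α : ℝ, 0 < α →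
    Tendsto (fun x : ℕ => (x : ℝ) ^ α * f x) atTop atTop ∧
    Tendsto (fun x : ℕ => (x : ℝ) ^ (-α) * f x) atTop (nhds 0)

/-- The class 𝒢 of functions `g : ℕ → ℝ` with `g 0 = 0`, `g 1 = 1`, `g x > 0` for `x > 0`. -/
def InG (g : ℕ → ℝ) : Prop :=
  g 0 = 0 ∧ g 1 = 1 ∧ ∀ x : ℕ, 0 < x → 0 < g x

/-- `g` is slow-dropping. -/
def SlowDropping (g : ℕ → ℝ) : Prop :=
  ∀ α : ℝ, 0 < α → ∃ N : ℕ, 0 < N ∧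
    ∀ x y : ℕ, x < y → N ≤ y → g x / (y : ℝ) ^ α ≤ g y

/-- `g` is slow-jumping. -/
def SlowJumping (g : ℕ → ℝ) : Prop :=
  ∀ α : ℝ, 0 < α → ∃ N : ℕ, 0 < N ∧
    ∀ x y : ℕ, 0 < x → x < y → N ≤ y →
      g y ≤ ((y / x : ℕ) : ℝ) ^ (2 + α) * (x : ℝ) ^ α * g x

/-- `δ_ε(g,x)`. -/
def deltaSet (g : ℕ → ℝ) (x : ℕ) (ε : ℝ) : Set ℕ :=
  {y : ℕ | |g y - g x| ≤ ε * g x}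

/-- `g` is predictable. -/
def Predictable (g : ℕ → ℝ) : Prop :=
  ∀ γ : ℝ, 0 < γ → γ < 1 → ∀ ε : ℕ → ℝ, SubPoly ε →
    ∃ N : ℕ, ∀ x : ℕ, N ≤ x → ∀ y : ℕ, 1 ≤ y → (y : ℝ) < (x : ℝ) ^ (1 - γ) →
      x + y ∉ deltaSet g x (ε x) → (x : ℝ) ^ (-γ) * g x ≤ g y

/-- `y` is an `α`-period of `g`. -/
def IsPeriod (g : ℕ → ℝ) (α : ℝ) (y : ℕ) : Prop :=
  ∃ x : ℕ, x < y ∧ g y ≤ g x / (y : ℝ) ^ α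

/-- `g` is `S`-nearly periodic. -/
def NearlyPeriodic (S : Set (ℕ → ℝ)) (g : ℕ → ℝ) : Prop :=
  (∃ α : ℝ, 0 < α ∧ ∀ N : ℕ, 0 < N → ∃ y : ℕ, N ≤ y ∧ IsPeriod g α y) ∧
  (∀ α : ℝ, 0 < α → ∀ h ∈ S, ∃ N₁ : ℕ, 0 < N₁ ∧
    ∀ y : ℕ, IsPeriod g α y → N₁ ≤ y →
      ∀ x : ℕ, x < y → g y * (y : ℝ) ^ α ≤ g x →
        |g (x + y) - g x| ≤ min (g x) (g (x + y)) * h y)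

/-- 𝕊 : the non-increasing sub-polynomial functions. -/
def SFuns : Set (ℕ → ℝ) := {h | SubPoly h ∧ Antitone h}

/-- ℙ : the strictly increasing polynomial functions. -/
def PFuns : Set (ℕ → ℝ) :=
  {h | (∃ p : Polynomial ℝ, ∀ n : ℕ, h n = p.eval (n : ℝ)) ∧ StrictMono h}

/-- `r_ε(x)`: the largest `y` such that `x + y' ∈ δ_ε(g,x)` for all `|y'| ≤ y`. -/
def rstab (g : ℕ → ℝ) (ε : ℝ) (x : ℕ) : ℕ :=
  sSup {y : ℕ | ∀ y' : ℕ, y' ≤ y →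
    x + y' ∈ deltaSet g x ε ∧ x - y' ∈ deltaSet g x ε}

/-- The extended metric Θ on 𝒢. -/
def Theta (g h : ℕ → ℝ) : ℝ≥0∞ :=
  ⨆ (x : ℕ) (_ : 1 ≤ x), ENNReal.ofReal |Real.log (g x) - Real.log (h x)|

/-- The largest ratio `g x / g y` over `x ≤ y`, truncated below at `1`. -/
def maxDrop (g : ℕ → ℝ) (y : ℕ) : ℝ :=
  max 1 ((Finset.range (y + 1)).sup' Finset.nonempty_range_add_one fun x => g x / g y)

theorem one_le_maxDrop (g : ℕ → ℝ) (y : ℕ) : 1 ≤ maxDrop g y :=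
  le_max_left _ _

theorem div_le_maxDrop (g : ℕ → ℝ) {x y : ℕ} (hxy : x ≤ y) : g x / g y ≤ maxDrop g y :=
  (Finset.le_sup' (fun x => g x / g y) (Finset.mem_range.2 (Nat.lt_succ_of_le hxy))).trans
    (le_max_right _ _)

theorem SlowDropping.eventually_maxDrop_le {g : ℕ → ℝ} (hs : SlowDropping g) (hg : InG g)
    {α : ℝ} (hα : 0 < α) : ∀ᶠ y : ℕ in atTop, maxDrop g y ≤ (y : ℝ) ^ α := by
  obtain ⟨N, hN, h⟩ := hs α hα
  filter_upwards [eventually_ge_atTop N] with y hy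
  have hy0 : 0 < y := hN.trans_le hy
  have hgy : 0 < g y := hg.2.2 y hy0
  have hpow : 0 < (y : ℝ) ^ α := rpow_pos_of_pos (Nat.cast_pos.2 hy0) α
  have hone : 1 ≤ (y : ℝ) ^ α := one_le_rpow (by exact_mod_cast hy0) hα.le
  refine max_le hone (Finset.sup'_le _ _ fun x hx => ?_)
  rcases (Nat.lt_succ_iff.1 (Finset.mem_range.1 hx)).lt_or_eq with hlt | rfl
  · rw [div_le_iff₀ hgy, mul_comm]
    exact (div_le_iff₀ hpow).1 (h x y hlt hy)
  · rwa [div_self hgy.ne']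

theorem SlowDropping.subPoly_maxDrop {g : ℕ → ℝ} (hs : SlowDropping g) (hg : InG g) :
    SubPoly (maxDrop g) := by
  have hnonneg : ∀ x, 0 ≤ maxDrop g x := fun x => zero_le_one.trans (one_le_maxDrop g x)
  refine ⟨hnonneg, fun α hα => ⟨?_, ?_⟩⟩
  · refine tendsto_atTop_mono (fun x => ?_)
      ((tendsto_rpow_atTop hα).comp tendsto_natCast_atTop_atTop)
    exact le_mul_of_one_le_right (rpow_nonneg x.cast_nonneg α) (one_le_maxDrop g x)
  · refine squeeze_zero' (Eventually.of_forall fun x =>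
      mul_nonneg (rpow_nonneg x.cast_nonneg _) (hnonneg x)) ?_
      ((tendsto_rpow_neg_atTop (half_pos hα)).comp tendsto_natCast_atTop_atTop)
    filter_upwards [hs.eventually_maxDrop_le hg (half_pos hα), eventually_gt_atTop 0] with x hx hx0
    calc (x : ℝ) ^ (-α) * maxDrop g x ≤ (x : ℝ) ^ (-α) * (x : ℝ) ^ (α / 2) := by gcongr
      _ = (x : ℝ) ^ (-(α / 2)) := by
        rw [← rpow_add (Nat.cast_pos.2 hx0)]
        congr 1
        ring

/-- `g ∈ 𝒢` is slow-dropping iff there is a sub-polynomial `h` with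
`g x ≤ g y * h y` for all positive integers `x < y`. -/
theorem slowDropping_iff_subpoly (g : ℕ → ℝ) (hg : InG g) :
    SlowDropping g ↔
      ∃ h : ℕ → ℝ, SubPoly h ∧ ∀ x y : ℕ, 0 < x → x < y → g x ≤ g y * h y := by
  constructor
  · intro hs
    refine ⟨maxDrop g, hs.subPoly_maxDrop hg, fun x y hx hxy => ?_⟩
    rw [mul_comm, ← div_le_iff₀ (hg.2.2 y (hx.trans hxy))]
    exact div_le_maxDrop g hxy.le
  · rintro ⟨h, ⟨-, hh⟩, hgh⟩ α hα
    obtain ⟨N, hN⟩ :=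
      eventually_atTop.1 ((hh α hα).2.eventually_lt_const (show (0 : ℝ) < 1 from one_pos))
    refine ⟨N + 1, N.succ_pos, fun x y hxy hy => ?_⟩
    have hy0 : 0 < y := x.zero_le.trans_lt hxy
    have hgy : 0 < g y := hg.2.2 y hy0
    have hpow : 0 < (y : ℝ) ^ α := rpow_pos_of_pos (Nat.cast_pos.2 hy0) α
    rcases x.eq_zero_or_pos with rfl | hx
    · simpa [hg.1] using hgy.le
    · have hlt := hN y (N.le_succ.trans hy)
      rw [rpow_neg y.cast_nonneg, inv_mul_lt_iff₀ hpow, mul_one] at hlt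
      rw [div_le_iff₀ hpow]
      exact (hgh x y hx hxy).trans (mul_le_mul_of_nonneg_left hlt.le hgy.le)

end
end

section
/- Let g be a function in 𝒢. Then g is slow-jumping if and only if there exists a sub-polynomial function h : ℕ → ℝ≥0 such that for all positive integers x < y, g(y) ≤ ⌊y/x⌋²·h(⌊y/x⌋·x)·g(x). -/
open Filter Real
open scoped ENNReal

noncomputable section

theorem Nat.lt_two_mul_div_mul {x y : ℕ} (hx : 0 < x) (hxy : x ≤ y) : y < 2 * (y / x * x) := by
  have h₁ : y < (y / x + 1) * x := Nat.lt_mul_of_div_lt (Nat.lt_succ_self _) hx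
  have h₂ : 1 * x ≤ y / x * x := Nat.mul_le_mul_right x (Nat.div_pos hxy hx)
  linarith

/-- A sub-polynomial function is eventually bounded by every positive power. -/
theorem SubPoly.eventually_le_rpow {h : ℕ → ℝ} (hh : SubPoly h) {α : ℝ} (hα : 0 < α) :
    ∀ᶠ z : ℕ in atTop, h z ≤ (z : ℝ) ^ α := by
  filter_upwards [((hh.2 α hα).2).eventually_lt_const one_pos, eventually_gt_atTop 0] with z hz hz0
  have hz0' : (0 : ℝ) < z := by exact_mod_cast hz0
  rw [rpow_neg hz0'.le, inv_mul_lt_iff₀ (rpow_pos_of_pos hz0' α), mul_one] at hz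
  exact hz.le

/-- A function that is at least one and eventually below every positive power is sub-polynomial. -/
theorem SubPoly.of_one_le {h : ℕ → ℝ} (h1 : ∀ z, 1 ≤ h z)
    (hle : ∀ α : ℝ, 0 < α → ∀ᶠ z : ℕ in atTop, h z ≤ (z : ℝ) ^ α) : SubPoly h := by
  refine ⟨fun z => zero_le_one.trans (h1 z), fun α hα => ⟨?_, ?_⟩⟩
  · refine tendsto_atTop_mono (fun z => ?_)
      ((tendsto_rpow_atTop hα).comp tendsto_natCast_atTop_atTop)
    exact le_mul_of_one_le_right (rpow_nonneg z.cast_nonneg α) (h1 z)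
  · refine squeeze_zero' (Eventually.of_forall fun z =>
      mul_nonneg (rpow_nonneg z.cast_nonneg _) (zero_le_one.trans (h1 z))) ?_
      ((tendsto_rpow_neg_atTop (half_pos hα)).comp tendsto_natCast_atTop_atTop)
    filter_upwards [hle (α / 2) (half_pos hα), eventually_gt_atTop 0] with z hz hz0
    have hz0' : (0 : ℝ) < z := by exact_mod_cast hz0
    calc (z : ℝ) ^ (-α) * h z ≤ (z : ℝ) ^ (-α) * (z : ℝ) ^ (α / 2) := by gcongr
      _ = (z : ℝ) ^ (-(α / 2)) := by rw [← rpow_add hz0']; congr 1; ring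

/-- For fixed `z` there is a least constant `m ≥ 1` bounding all the ratios
`g y / (⌊y/x⌋² * g x)` with `⌊y/x⌋ * x = z`. -/
theorem exists_least_jump_bound {g : ℕ → ℝ} (hg : ∀ x : ℕ, 0 < x → 0 < g x) (z : ℕ) :
    ∃ m : ℝ, 1 ≤ m ∧
      (∀ x y : ℕ, 0 < x → x < y → y / x * x = z →
        g y ≤ ((y / x : ℕ) : ℝ) ^ 2 * m * g x) ∧
      ∀ B : ℝ, 1 ≤ B →
        (∀ x y : ℕ, 0 < x → x < y → y / x * x = z →
          g y ≤ ((y / x : ℕ) : ℝ) ^ 2 * B * g x) → m ≤ B := by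
  have key (x y : ℕ) (hx : 0 < x) (hxy : x < y) (B : ℝ) :
      g y ≤ ((y / x : ℕ) : ℝ) ^ 2 * B * g x ↔ g y / (((y / x : ℕ) : ℝ) ^ 2 * g x) ≤ B := by
    have hq : (0 : ℝ) < (y / x : ℕ) := by exact_mod_cast Nat.div_pos hxy.le hx
    rw [div_le_iff₀ (mul_pos (pow_pos hq 2) (hg x hx))]
    constructor <;> intro h <;> linarith
  set S : Set ℝ := insert 1 ((fun p : ℕ × ℕ => g p.2 / (((p.2 / p.1 : ℕ) : ℝ) ^ 2 * g p.1)) ''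
    {p | 0 < p.1 ∧ p.1 < p.2 ∧ p.2 / p.1 * p.1 = z})
  have hfin : S.Finite := by
    refine (Set.Finite.image _ ?_).insert 1
    refine ((Set.finite_Iio (2 * z)).prod (Set.finite_Iio (2 * z))).subset ?_
    rintro ⟨x, y⟩ ⟨hx, hxy, hz⟩
    have := Nat.lt_two_mul_div_mul hx hxy.le
    simp only at hx hxy hz this
    rw [hz] at this
    exact ⟨hxy.trans this, this⟩
  have hlub : IsLUB S (sSup S) := isLUB_csSup ⟨1, Set.mem_insert _ _⟩ hfin.bddAbove
  refine ⟨sSup S, hlub.1 (Set.mem_insert _ _), fun x y hx hxy hz => ?_, fun B hB h => hlub.2 ?_⟩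
  · exact (key x y hx hxy _).2 (hlub.1 (Set.mem_insert_of_mem _ ⟨(x, y), ⟨hx, hxy, hz⟩, rfl⟩))
  · rintro _ (rfl | ⟨⟨x, y⟩, ⟨hx, hxy, hz⟩, rfl⟩)
    · exact hB
    · exact (key x y hx hxy B).1 (h x y hx hxy hz)

theorem Real.rpow_two_add_mul_rpow {q x : ℝ} (hq : 0 < q) (hx : 0 ≤ x) (α : ℝ) :
    q ^ (2 + α) * x ^ α = q ^ 2 * (q * x) ^ α := by
  rw [rpow_add hq, mul_rpow hq.le hx, rpow_two, mul_assoc]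

/-- `g ∈ 𝒢` is slow-jumping iff there is a sub-polynomial `h` with
`g y ≤ ⌊y/x⌋² * h(⌊y/x⌋ * x) * g x` for all positive integers `x < y`. -/
theorem slowJumping_iff_subpoly (g : ℕ → ℝ) (hg : InG g) :
    SlowJumping g ↔
      ∃ h : ℕ → ℝ, SubPoly h ∧ ∀ x y : ℕ, 0 < x → x < y →
        g y ≤ ((y / x : ℕ) : ℝ) ^ (2 : ℕ) * h ((y / x) * x) * g x := by
  obtain ⟨-, -, hpos⟩ := hg
  have hdiv {x y : ℕ} (hx : 0 < x) (hxy : x < y) : (0 : ℝ) < (y / x : ℕ) := by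
    exact_mod_cast Nat.div_pos hxy.le hx
  constructor
  · intro hsj
    choose h h1 hbound hleast using exists_least_jump_bound hpos
    refine ⟨h, SubPoly.of_one_le h1 fun α hα => ?_, fun x y hx hxy => hbound _ x y hx hxy rfl⟩
    obtain ⟨N, hN, hjump⟩ := hsj α hα
    filter_upwards [eventually_ge_atTop N] with z hz
    have hz1 : (1 : ℝ) ≤ z := by exact_mod_cast hN.trans_le hz
    refine hleast z _ (one_le_rpow hz1 hα.le) fun x y hx hxy hxyz => ?_
    have hzy : z ≤ y := hxyz ▸ Nat.div_mul_le_self y x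
    have := hjump x y hx hxy (hz.trans hzy)
    rwa [rpow_two_add_mul_rpow (hdiv hx hxy) x.cast_nonneg, ← Nat.cast_mul, hxyz] at this
  · rintro ⟨h, hh, hbound⟩ α hα
    obtain ⟨M, hM⟩ := eventually_atTop.1 (hh.eventually_le_rpow hα)
    refine ⟨2 * M + 1, Nat.succ_pos _, fun x y hx hxy hy => ?_⟩
    have hlt := Nat.lt_two_mul_div_mul hx hxy.le
    have hz := hM (y / x * x) (by omega)
    rw [rpow_two_add_mul_rpow (hdiv hx hxy) x.cast_nonneg, ← Nat.cast_mul]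
    refine (hbound x y hx hxy).trans ?_
    have := (hpos x hx).le
    gcongr

end
end

section
/- Let g be a function in 𝒢. Then g is predictable if and only if for every sub-polynomial function ε with ε(x) > 0, there exists a sub-polynomial function h such that for every x ∈ ℕ and every integer y with 1 ≤ y < x/h(x) satisfying x + y ∉ δ_{ε(x)}(g,x), one has g(y) ≥ g(x)/h(x). -/
open Filter Real
open scoped ENNReal

noncomputable section

/-- A function bounded below by `1` and eventually bounded above by `2 * x ^ γ` for all small
`γ > 0` is sub-polynomial. -/
theorem SubPoly.of_one_le_s2 {h : ℕ → ℝ} (h_one : ∀ x, 1 ≤ h x)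
    (h_le : ∀ γ : ℝ, 0 < γ → γ < 1 → ∀ᶠ x : ℕ in atTop, h x ≤ 2 * (x : ℝ) ^ γ) :
    SubPoly h := by
  refine ⟨fun x => zero_le_one.trans (h_one x), fun α hα => ⟨?_, ?_⟩⟩
  · refine tendsto_atTop_mono (fun x => ?_)
      ((tendsto_rpow_atTop hα).comp tendsto_natCast_atTop_atTop)
    exact le_mul_of_one_le_right (rpow_nonneg (Nat.cast_nonneg x) α) (h_one x)
  · have hγ : 0 < min (α / 2) (1 / 2) := lt_min (half_pos hα) (by norm_num)
    have h_lim : Tendsto (fun x : ℕ => 2 * (x : ℝ) ^ (-(α / 2))) atTop (nhds 0) := by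
      simpa using ((tendsto_rpow_neg_atTop (half_pos hα)).comp
        tendsto_natCast_atTop_atTop).const_mul (2 : ℝ)
    refine squeeze_zero' (Eventually.of_forall fun x => ?_) ?_ h_lim
    · exact mul_nonneg (by positivity) (zero_le_one.trans (h_one x))
    · filter_upwards [h_le _ hγ ((min_le_right _ _).trans_lt (by norm_num)),
        eventually_ge_atTop 1] with x hx hx1
      have hx1' : (1 : ℝ) ≤ x := by exact_mod_cast hx1
      have hx2 : h x ≤ 2 * (x : ℝ) ^ (α / 2) :=
        hx.trans (by gcongr; exact min_le_left _ _)
      calc (x : ℝ) ^ (-α) * h x ≤ (x : ℝ) ^ (-α) * (2 * (x : ℝ) ^ (α / 2)) := by gcongr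
        _ = 2 * ((x : ℝ) ^ (-α) * (x : ℝ) ^ (α / 2)) := by ring
        _ = 2 * (x : ℝ) ^ (-(α / 2)) := by
          rw [← rpow_add (by linarith)]
          ring_nf

/-- A sub-polynomial function is eventually positive. -/
theorem SubPoly.eventually_pos {f : ℕ → ℝ} (hf : SubPoly f) : ∀ᶠ x in atTop, 0 < f x := by
  filter_upwards [(hf.2 1 one_pos).1.eventually_gt_atTop 0] with x hx
  exact pos_of_mul_pos_right hx (by positivity)

/-- A sub-polynomial function is eventually at most `x ^ γ`, for every `γ > 0`. -/
theorem SubPoly.eventually_le_rpow_s2 {f : ℕ → ℝ} (hf : SubPoly f) {γ : ℝ} (hγ : 0 < γ) :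
    ∀ᶠ x : ℕ in atTop, f x ≤ (x : ℝ) ^ γ := by
  filter_upwards [(hf.2 γ hγ).2.eventually_le_const one_pos, eventually_ge_atTop 1] with x hx hx1
  have hx0 : (0 : ℝ) < x := by exact_mod_cast hx1
  rwa [rpow_neg hx0.le, inv_mul_le_one₀ (by positivity)] at hx

/-- Being sub-polynomial only depends on the values near infinity, up to nonnegativity. -/
theorem SubPoly.congr' {f f' : ℕ → ℝ} (hf : SubPoly f) (h_nonneg : ∀ x, 0 ≤ f' x)
    (h_eq : f =ᶠ[atTop] f') : SubPoly f' :=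
  ⟨h_nonneg, fun α hα =>
    ⟨(hf.2 α hα).1.congr' (h_eq.mono fun x hx => by simp only [hx]),
      (hf.2 α hα).2.congr' (h_eq.mono fun x hx => by simp only [hx])⟩⟩

/-- `g y ≥ g x / t` for every `1 ≤ y < x / t` such that `x + y ∉ δ_ε(g, x)`. -/
def PredictableAt (g : ℕ → ℝ) (ε : ℝ) (x : ℕ) (t : ℝ) : Prop :=
  ∀ y : ℕ, 1 ≤ y → (y : ℝ) < (x : ℝ) / t → x + y ∉ deltaSet g x ε → g x / t ≤ g y

theorem PredictableAt.mono {g : ℕ → ℝ} {ε : ℝ} {x : ℕ} {s t : ℝ} (hgx : 0 ≤ g x)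
    (hs : 0 < s) (hst : s ≤ t) (h : PredictableAt g ε x s) : PredictableAt g ε x t :=
  fun y hy1 hy hxy => (div_le_div_of_nonneg_left hgx hs hst).trans
    (h y hy1 (hy.trans_le (div_le_div_of_nonneg_left (Nat.cast_nonneg x) hs hst)) hxy)

theorem predictableAt_add_one (g : ℕ → ℝ) (ε : ℝ) (x : ℕ) :
    PredictableAt g ε x (x + 1) := by
  intro y hy1 hy _
  have hy1' : (1 : ℝ) ≤ y := by exact_mod_cast hy1
  have : (x : ℝ) / (x + 1) ≤ 1 := (div_le_one (by positivity)).2 (by linarith)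
  linarith

theorem InG.nonneg {g : ℕ → ℝ} (hg : InG g) (x : ℕ) : 0 ≤ g x := by
  rcases Nat.eq_zero_or_pos x with rfl | hx
  · exact hg.1.ge
  · exact (hg.2.2 x hx).le

/-- `g ∈ 𝒢` is predictable iff for every positive sub-polynomial `ε`
there is a sub-polynomial `h` such that for all `x` and `1 ≤ y < x / h x` with
`x + y ∉ δ_{ε x}(g, x)` one has `g y ≥ g x / h x`. -/
theorem predictable_iff_subpoly (g : ℕ → ℝ) (hg : InG g) :
    Predictable g ↔
      ∀ ε : ℕ → ℝ, SubPoly ε → (∀ x, 0 < ε x) →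
        ∃ h : ℕ → ℝ, SubPoly h ∧
          ∀ x y : ℕ, 1 ≤ y → (y : ℝ) < (x : ℝ) / h x →
            x + y ∉ deltaSet g x (ε x) → g x / h x ≤ g y := by
  constructor
  · intro hp ε hε _
    let S : ℕ → Set ℝ := fun x => {t | 1 ≤ t ∧ PredictableAt g (ε x) x t}
    have hS_ne (x : ℕ) : (S x).Nonempty :=
      ⟨x + 1, by simp, predictableAt_add_one g (ε x) x⟩
    have hS_bdd (x : ℕ) : BddBelow (S x) := ⟨1, fun _ ht => ht.1⟩
    have hS_one (x : ℕ) : 1 ≤ sInf (S x) := le_csInf (hS_ne x) fun _ ht => ht.1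
    refine ⟨fun x => 2 * sInf (S x), SubPoly.of_one_le_s2 (fun x => ?_) fun γ hγ hγ1 => ?_,
      fun x => ?_⟩
    · linarith [hS_one x]
    · obtain ⟨N, hN⟩ := hp γ hγ hγ1 ε hε
      filter_upwards [eventually_ge_atTop N, eventually_ge_atTop 1] with x hxN hx1
      have hx1' : (1 : ℝ) ≤ x := by exact_mod_cast hx1
      have hx0 : (0 : ℝ) < x := by linarith
      refine mul_le_mul_of_nonneg_left
        (csInf_le (hS_bdd x) ⟨one_le_rpow hx1' hγ.le, fun y hy1 hy hxy => ?_⟩) zero_le_two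
      have := hN x hxN y hy1 (by rwa [rpow_sub hx0, rpow_one]) hxy
      rwa [rpow_neg hx0.le, inv_mul_eq_div] at this
    · obtain ⟨t, ht, ht_lt⟩ := exists_lt_of_csInf_lt (hS_ne x)
        (show sInf (S x) < 2 * sInf (S x) by linarith [hS_one x])
      exact ht.2.mono (hg.nonneg x) (by linarith [ht.1]) ht_lt.le
  · intro H γ hγ _ ε hε
    have h_eq : ε =ᶠ[atTop] fun x => if 0 < ε x then ε x else 1 :=
      hε.eventually_pos.mono fun x hx => (if_pos hx).symm
    have h_pos (x : ℕ) : 0 < if 0 < ε x then ε x else 1 := by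
      split_ifs with hx
      exacts [hx, one_pos]
    obtain ⟨h, hh, hh'⟩ := H _ (hε.congr' (fun x => (h_pos x).le) h_eq) h_pos
    refine eventually_atTop.1 ?_
    filter_upwards [h_eq, hh.eventually_pos, hh.eventually_le_rpow_s2 hγ, eventually_ge_atTop 1]
      with x hεx hhx hhγ hx1 y hy1 hy hxy
    have hx0 : (0 : ℝ) < x := by exact_mod_cast hx1
    have h_at : PredictableAt g (ε x) x (h x) := by
      rw [hεx]
      exact hh' x
    rw [rpow_neg hx0.le, inv_mul_eq_div]
    exact h_at.mono (hg.nonneg x) hhx hhγ y hy1 (by rwa [rpow_sub hx0, rpow_one] at hy) hxy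

end
end

section
/- Let g ∈ 𝒢 be slow-dropping, slow-jumping, and predictable, and let ε be a sub-polynomial function with 0 < ε(x) < 1/2 for all x. Then there exists a sub-polynomial function h such that for every x ∈ ℕ and every integer y with r_{ε(x)}(x) + 1 ≤ y < x/h(x), one has g(y) ≥ g(x)/h(x). -/
open Filter Real
open scoped ENNReal

noncomputable section

theorem SubPoly.of_pos_rpow_inv {k : ℕ → ℕ} (hk : Tendsto k atTop atTop) :
    SubPoly (fun x : ℕ => (x : ℝ) ^ ((1 : ℝ) / ((k x : ℝ) + 1))) := by
  refine ⟨fun x => by positivity, fun α hα => ⟨?_, ?_⟩⟩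
  · refine tendsto_atTop_mono' atTop ?_
      ((tendsto_rpow_atTop hα).comp tendsto_natCast_atTop_atTop)
    filter_upwards [eventually_ge_atTop 1] with x hx
    have hx1 : (1 : ℝ) ≤ x := by exact_mod_cast hx
    have h1 : (1 : ℝ) ≤ (x : ℝ) ^ ((1 : ℝ) / ((k x : ℝ) + 1)) :=
      Real.one_le_rpow hx1 (by positivity)
    exact le_mul_of_one_le_right (Real.rpow_nonneg (Nat.cast_nonneg x) α) h1
  · refine squeeze_zero' (Eventually.of_forall fun x : ℕ =>
      mul_nonneg (by positivity) (Real.rpow_nonneg (Nat.cast_nonneg x) _)) ?_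
      ((tendsto_rpow_neg_atTop (half_pos hα)).comp tendsto_natCast_atTop_atTop)
    have hlim : Tendsto (fun x => (1 : ℝ) / ((k x : ℝ) + 1)) atTop (nhds 0) :=
      tendsto_one_div_add_atTop_nhds_zero_nat.comp hk
    filter_upwards [eventually_ge_atTop 1, hlim.eventually_lt_const (half_pos hα)] with x hx hkx
    have hx1 : (1 : ℝ) ≤ x := by exact_mod_cast hx
    rw [← Real.rpow_add (by linarith)]
    exact Real.rpow_le_rpow_of_exponent_le hx1 (by linarith)

/-- A diagonal argument: eventual properties can be satisfied along an index tending to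
infinity. -/
theorem exists_tendsto_atTop_forall {P : ℕ → ℕ → Prop} (h0 : ∀ x, P 0 x)
    (hP : ∀ k, ∀ᶠ x in atTop, P k x) :
    ∃ k : ℕ → ℕ, Tendsto k atTop atTop ∧ ∀ x, P (k x) x := by
  classical
  refine ⟨fun x => Nat.findGreatest (fun k => P k x) x, ?_, fun x => ?_⟩
  · refine tendsto_atTop.2 fun m => ?_
    filter_upwards [eventually_ge_atTop m, hP m] with x hx hm
    exact Nat.le_findGreatest hx hm
  · exact Nat.findGreatest_spec (P := fun k => P k x) (Nat.zero_le x) (h0 x)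

/-- Half of the minimum of `ε` over `[x, 2x]`. -/
def dyadicMin (ε : ℕ → ℝ) (x : ℕ) : ℝ :=
  (Finset.Icc x (2 * x)).inf' ⟨x, by simp; omega⟩ ε / 2

theorem dyadicMin_le {ε : ℕ → ℝ} {x z : ℕ} (h₁ : x ≤ z) (h₂ : z ≤ 2 * x) :
    dyadicMin ε x ≤ ε z / 2 := by
  unfold dyadicMin
  have := Finset.inf'_le ε (Finset.mem_Icc.2 ⟨h₁, h₂⟩)
  linarith

theorem le_dyadicMin {ε : ℕ → ℝ} {x : ℕ} {a : ℝ}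
    (h : ∀ z, x ≤ z → z ≤ 2 * x → a ≤ ε z) : a / 2 ≤ dyadicMin ε x := by
  unfold dyadicMin
  have : a ≤ (Finset.Icc x (2 * x)).inf' ⟨x, by simp; omega⟩ ε :=
    Finset.le_inf' _ _ fun z hz => h z (Finset.mem_Icc.1 hz).1 (Finset.mem_Icc.1 hz).2
  linarith

theorem SubPoly.dyadicMin {ε : ℕ → ℝ} (hε : SubPoly ε) : SubPoly (dyadicMin ε) := by
  have hnn : ∀ x, 0 ≤ _root_.dyadicMin ε x := fun x => by
    simpa using le_dyadicMin (x := x) (a := 0) fun z _ _ => hε.1 z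
  refine ⟨hnn, fun α hα => ⟨?_, ?_⟩⟩
  · have hev := (hε.2 (α / 2) (half_pos hα)).1.eventually_ge_atTop 1
    obtain ⟨M, hM⟩ := eventually_atTop.1 hev
    have hc : (0 : ℝ) < (2 : ℝ) ^ (-(α / 2)) / 2 := by positivity
    refine tendsto_atTop_mono' atTop ?_ (((tendsto_rpow_atTop (half_pos hα)).comp
      tendsto_natCast_atTop_atTop).const_mul_atTop hc)
    filter_upwards [eventually_ge_atTop 1, eventually_ge_atTop M] with x hx hxM
    have hx0 : (0 : ℝ) < x := by exact_mod_cast hx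
    have key : ((2 * x : ℕ) : ℝ) ^ (-(α / 2)) / 2 ≤ _root_.dyadicMin ε x := by
      refine le_dyadicMin fun z h₁ h₂ => ?_
      have hz0 : (0 : ℝ) < z := by exact_mod_cast lt_of_lt_of_le hx h₁
      have h2 : (z : ℝ) ≤ ((2 * x : ℕ) : ℝ) := by exact_mod_cast h₂
      calc ((2 * x : ℕ) : ℝ) ^ (-(α / 2)) ≤ (z : ℝ) ^ (-(α / 2)) :=
            Real.rpow_le_rpow_of_nonpos hz0 h2 (by linarith)
        _ ≤ (z : ℝ) ^ (-(α / 2)) * ((z : ℝ) ^ (α / 2) * ε z) :=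
            le_mul_of_one_le_right (by positivity) (hM z (hxM.trans h₁))
        _ = ε z := by
            rw [← mul_assoc, ← Real.rpow_add hz0]; simp
    calc (2 : ℝ) ^ (-(α / 2)) / 2 * (x : ℝ) ^ (α / 2)
        = (x : ℝ) ^ α * (((2 * x : ℕ) : ℝ) ^ (-(α / 2)) / 2) := by
          push_cast
          rw [Real.mul_rpow (by norm_num) hx0.le,
            show (α / 2 : ℝ) = α + -(α / 2) by ring, Real.rpow_add hx0]
          ring_nf
      _ ≤ _ := by gcongr
  · refine squeeze_zero (fun x => mul_nonneg (by positivity) (hnn x)) (fun x => ?_)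
      (hε.2 α hα).2
    have h := dyadicMin_le (ε := ε) (x := x) (z := x) le_rfl (by omega)
    have := hε.1 x
    gcongr
    linarith

theorem exists_not_mem_deltaSet {g : ℕ → ℝ} (hg : InG g) {ε : ℝ} (hε0 : 0 ≤ ε) (hε1 : ε < 1)
    {x y : ℕ} (hx : 0 < x) (hy : rstab g ε x + 1 ≤ y) :
    ∃ z, 1 ≤ z ∧ z ≤ y ∧ (x + z ∉ deltaSet g x ε ∨ x - z ∉ deltaSet g x ε) := by
  have hgx := hg.2.2 x hx
  have hbdd : BddAbove {y : ℕ | ∀ y' : ℕ, y' ≤ y →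
      x + y' ∈ deltaSet g x ε ∧ x - y' ∈ deltaSet g x ε} := by
    refine ⟨x, fun m hm => ?_⟩
    by_contra! hlt
    have h := (hm x hlt.le).2
    simp only [deltaSet, Nat.sub_self, Set.mem_ofPred_eq, hg.1, zero_sub, abs_neg,
      abs_of_pos hgx] at h
    nlinarith
  have hnot : ¬ ∀ y' : ℕ, y' ≤ rstab g ε x + 1 →
      x + y' ∈ deltaSet g x ε ∧ x - y' ∈ deltaSet g x ε := fun h => by
    have : rstab g ε x + 1 ≤ rstab g ε x := le_csSup hbdd h
    omega
  push Not at hnot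
  obtain ⟨z, hz, hzn⟩ := hnot
  refine ⟨z, ?_, hz.trans hy, ?_⟩
  · rcases Nat.eq_zero_or_pos z with rfl | h
    · have hmem : x ∈ deltaSet g x ε := by
        simpa [deltaSet] using mul_nonneg hε0 hgx.le
      exact absurd hmem (hzn hmem)
    · exact h
  · by_cases h : x + z ∈ deltaSet g x ε
    · exact Or.inr (hzn h)
    · exact Or.inl h

/-- Slow-dropping with a multiplicative constant holds without a lower bound on the argument. -/
theorem SlowDropping.exists_const {g : ℕ → ℝ} (hg : InG g) (hsd : SlowDropping g)
    {β : ℝ} (hβ : 0 < β) :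
    ∃ c : ℝ, 0 < c ∧ ∀ z y : ℕ, 1 ≤ z → z ≤ y → c * g z / (y : ℝ) ^ β ≤ g y := by
  obtain ⟨N, hN, hsd⟩ := hsd β hβ
  have hne : (Finset.Icc 1 N).Nonempty := ⟨1, by simp; omega⟩
  obtain ⟨a, ha, hmin⟩ := Finset.exists_min_image (Finset.Icc 1 N) g hne
  obtain ⟨b, hb, hmax⟩ := Finset.exists_max_image (Finset.Icc 1 N) g hne
  have ha0 : 0 < g a := hg.2.2 a (Finset.mem_Icc.1 ha).1
  have hb0 : 0 < g b := hg.2.2 b (Finset.mem_Icc.1 hb).1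
  have hab : g a ≤ g b := hmin b hb
  have hc1 : g a / g b ≤ 1 := (div_le_one hb0).2 hab
  have hc0 : 0 < g a / g b := by positivity
  refine ⟨g a / g b, hc0, fun z y hz hzy => ?_⟩
  have hgz := hg.2.2 z hz
  have hy1 : (1 : ℝ) ≤ y := by exact_mod_cast hz.trans hzy
  have hyβ : (1 : ℝ) ≤ (y : ℝ) ^ β := Real.one_le_rpow hy1 hβ.le
  have hdrop : g a / g b * g z / (y : ℝ) ^ β ≤ g a / g b * g z :=
    div_le_self (by positivity) hyβ
  rcases hzy.eq_or_lt with rfl | hlt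
  · exact hdrop.trans (mul_le_of_le_one_left hgz.le hc1)
  rcases le_total N y with hNy | hyN
  · refine le_trans ?_ (hsd z y hlt hNy)
    gcongr
    exact mul_le_of_le_one_left hgz.le hc1
  · refine hdrop.trans ?_
    have h1 : g z ≤ g b := hmax z (Finset.mem_Icc.2 ⟨hz, hzy.trans hyN⟩)
    calc g a / g b * g z ≤ g a / g b * g b := by gcongr
      _ = g a := by field_simp
      _ ≤ g y := hmin y (Finset.mem_Icc.2 ⟨hz.trans hzy, hyN⟩)

theorem not_mem_deltaSet_of_not_mem {g : ℕ → ℝ} {x w : ℕ} {e η : ℝ} (hx : 0 ≤ g x) (hw : 0 ≤ g w)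
    (hη0 : 0 ≤ η) (hη : η ≤ e / 2) (he : e < 1 / 2) (h : w ∉ deltaSet g x e) :
    x ∉ deltaSet g w η := by
  simp only [deltaSet, Set.mem_ofPred_eq, not_le] at h ⊢
  rw [abs_sub_comm]
  rcases le_total (g w) (2 * g x) with h2 | h2
  · nlinarith
  · have := le_abs_self (g w - g x)
    nlinarith

theorem not_mem_deltaSet_mono {g : ℕ → ℝ} {x w : ℕ} {e η : ℝ} (hx : 0 ≤ g x)
    (hη : η ≤ e) (h : w ∉ deltaSet g x e) : w ∉ deltaSet g x η := by
  simp only [deltaSet, Set.mem_ofPred_eq, not_le] at h ⊢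
  exact lt_of_le_of_lt (mul_le_mul_of_nonneg_right hη hx) h

/-- For a fixed exponent, both upward and downward instability force `g` to be large at the
offset. -/
theorem eventually_rpow_neg_mul_le_of_not_mem {g : ℕ → ℝ} (hg : InG g) (hsj : SlowJumping g)
    (hp : Predictable g) {ε : ℕ → ℝ} (hε : SubPoly ε) (hεb : ∀ x, 0 < ε x ∧ ε x < 1 / 2)
    {β γ : ℝ} (hβ : 0 < β) (hβγ : β < γ) (hγ : γ < 1) :
    ∀ᶠ x : ℕ in atTop, ∀ z : ℕ, 1 ≤ z → (z : ℝ) < (x : ℝ) ^ (1 - γ) →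
      (x + z ∉ deltaSet g x (ε x) ∨ x - z ∉ deltaSet g x (ε x)) →
      (x : ℝ) ^ (-(2 * β)) * g x ≤ g z := by
  obtain ⟨N, hN⟩ := hp β hβ (hβγ.trans hγ) (dyadicMin ε) hε.dyadicMin
  obtain ⟨M, -, hM⟩ := hsj β hβ
  have hlim : ∀ a : ℝ, 0 < a → Tendsto (fun x : ℕ => (x : ℝ) ^ a) atTop atTop := fun a ha =>
    (tendsto_rpow_atTop ha).comp tendsto_natCast_atTop_atTop
  filter_upwards [eventually_ge_atTop 1, eventually_ge_atTop (2 * N), eventually_ge_atTop M,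
    (hlim γ (hβ.trans hβγ)).eventually_ge_atTop 4,
    (hlim (γ - β) (sub_pos.2 hβγ)).eventually_ge_atTop 2] with x hx hxN hxM hx4 hx2 z hz hzx h
  have hx1 : (1 : ℝ) ≤ x := by exact_mod_cast hx
  have hx0 : (0 : ℝ) < x := by linarith
  have hgx := hg.2.2 x hx
  have hηnn := hε.dyadicMin.1
  rcases h with h | h
  · have h' := not_mem_deltaSet_mono (η := dyadicMin ε x) hgx.le (by
      have := dyadicMin_le (ε := ε) (x := x) (z := x) le_rfl (by omega)
      linarith [(hεb x).1]) h
    have hlt : (z : ℝ) < (x : ℝ) ^ (1 - β) :=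
      hzx.trans_le (Real.rpow_le_rpow_of_exponent_le hx1 (by linarith))
    refine le_trans ?_ (hN x (by omega) z hz hlt h')
    gcongr
    linarith
  · have hz4 : 4 * (z : ℝ) < x := by
      rw [Real.rpow_sub hx0, Real.rpow_one, lt_div_iff₀ (by positivity)] at hzx
      have : (0 : ℝ) ≤ z := by positivity
      nlinarith
    have hz4' : 4 * z < x := by exact_mod_cast hz4
    obtain ⟨w, rfl⟩ : ∃ w, x = w + z := ⟨x - z, by omega⟩
    rw [Nat.add_sub_cancel] at h
    have hw : 0 < w := by omega
    have hgw := hg.2.2 w hw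
    have h' : w + z ∉ deltaSet g w (dyadicMin ε w) :=
      not_mem_deltaSet_of_not_mem hgx.le hgw.le (hηnn w)
        (dyadicMin_le (by omega) (by omega)) (hεb _).2 h
    have hw0 : (0 : ℝ) < w := by exact_mod_cast hw
    have hlt : (z : ℝ) < (w : ℝ) ^ (1 - β) := by
      have hhalf : ((w + z : ℕ) : ℝ) / 2 ≤ w := by push_cast at hz4 ⊢; linarith
      calc (z : ℝ) < ((w + z : ℕ) : ℝ) ^ (1 - γ) := hzx
        _ ≤ ((w + z : ℕ) : ℝ) ^ (1 - β) / 2 := by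
            rw [le_div_iff₀ (by norm_num), show 1 - β = (1 - γ) + (γ - β) by ring,
              Real.rpow_add hx0]
            gcongr
        _ ≤ ((w + z : ℕ) : ℝ) ^ (1 - β) / 2 ^ (1 - β) := by
            gcongr
            exact (Real.rpow_le_rpow_of_exponent_le one_le_two (by linarith)).trans_eq
              (Real.rpow_one 2)
        _ = (((w + z : ℕ) : ℝ) / 2) ^ (1 - β) := (Real.div_rpow hx0.le (by norm_num) _).symm
        _ ≤ (w : ℝ) ^ (1 - β) := Real.rpow_le_rpow (by positivity) hhalf (by linarith)
    have hpred := hN w (by omega) z hz hlt h'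
    have hjump := hM w (w + z) hw (by omega) hxM
    rw [Nat.div_eq_of_lt_le (k := 1) (by omega) (by omega), Nat.cast_one, Real.one_rpow,
      one_mul] at hjump
    have hwx : (w : ℝ) ≤ ((w + z : ℕ) : ℝ) := by exact_mod_cast Nat.le_add_right w z
    calc ((w + z : ℕ) : ℝ) ^ (-(2 * β)) * g (w + z)
        ≤ (w : ℝ) ^ (-(2 * β)) * ((w : ℝ) ^ β * g w) :=
          mul_le_mul (Real.rpow_le_rpow_of_nonpos hw0 hwx (by linarith)) hjump hgx.le
            (by positivity)
      _ = (w : ℝ) ^ (-β) * g w := by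
          rw [← mul_assoc, ← Real.rpow_add hw0]
          ring_nf
      _ ≤ g z := hpred

theorem eventually_rpow_neg_mul_le {g : ℕ → ℝ} (hg : InG g) (hsd : SlowDropping g)
    (hsj : SlowJumping g) (hp : Predictable g) {ε : ℕ → ℝ} (hε : SubPoly ε)
    (hεb : ∀ x, 0 < ε x ∧ ε x < 1 / 2) {γ : ℝ} (hγ0 : 0 < γ) (hγ : γ < 1) :
    ∀ᶠ x : ℕ in atTop, ∀ y : ℕ, rstab g (ε x) x + 1 ≤ y → (y : ℝ) < (x : ℝ) ^ (1 - γ) →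
      (x : ℝ) ^ (-γ) * g x ≤ g y := by
  have hβ : 0 < γ / 4 := by positivity
  obtain ⟨c, hc, hdrop⟩ := hsd.exists_const hg hβ
  have hlim : Tendsto (fun x : ℕ => (x : ℝ) ^ (γ / 4)) atTop atTop :=
    (tendsto_rpow_atTop hβ).comp tendsto_natCast_atTop_atTop
  filter_upwards [eventually_ge_atTop 1, hlim.eventually_ge_atTop c⁻¹,
    eventually_rpow_neg_mul_le_of_not_mem hg hsj hp hε hεb hβ (by linarith) hγ]
    with x hx hxc hloc y hy hyx
  have hx1 : (1 : ℝ) ≤ x := by exact_mod_cast hx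
  have hx0 : (0 : ℝ) < x := by linarith
  have hgx := hg.2.2 x hx
  obtain ⟨z, hz, hzy, hmem⟩ :=
    exists_not_mem_deltaSet hg (hεb x).1.le (by linarith [(hεb x).2]) hx hy
  have hzy' : (z : ℝ) ≤ y := by exact_mod_cast hzy
  have hgz := hloc z hz (hzy'.trans_lt hyx) hmem
  have hy0 : (0 : ℝ) < y := by exact_mod_cast lt_of_lt_of_le hz hzy
  have hyx' : (y : ℝ) ≤ x := hyx.le.trans
    ((Real.rpow_le_rpow_of_exponent_le hx1 (by linarith)).trans_eq (Real.rpow_one _))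
  have hgz0 := hg.2.2 z hz
  have hcx : (x : ℝ) ^ (-(γ / 4)) ≤ c := by
    rw [Real.rpow_neg hx0.le]
    exact inv_le_of_inv_le₀ hc hxc
  refine le_trans ?_ (hdrop z y hz hzy)
  calc (x : ℝ) ^ (-γ) * g x
      = (x : ℝ) ^ (-(γ / 4)) * ((x : ℝ) ^ (-(2 * (γ / 4))) * g x) * (x : ℝ) ^ (-(γ / 4)) := by
        rw [show -γ = -(γ / 4) + -(2 * (γ / 4)) + -(γ / 4) by ring, Real.rpow_add hx0,
          Real.rpow_add hx0]
        ring
    _ = (x : ℝ) ^ (-(γ / 4)) * ((x : ℝ) ^ (-(2 * (γ / 4))) * g x) / (x : ℝ) ^ (γ / 4) := by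
        rw [div_eq_mul_inv _ ((x : ℝ) ^ (γ / 4)), ← Real.rpow_neg hx0.le (γ / 4)]
    _ ≤ c * g z / (y : ℝ) ^ (γ / 4) := by gcongr

/-- Predictability booster: if `g ∈ 𝒢` is slow-dropping,
slow-jumping and predictable and `ε` is sub-polynomial with `0 < ε x < 1/2`,
then there is a sub-polynomial `h` such that for all `x` and all
`r_{ε x}(x) + 1 ≤ y < x / h x` one has `g y ≥ g x / h x`. -/
theorem predictability_booster (g : ℕ → ℝ) (hg : InG g)
    (hsd : SlowDropping g) (hsj : SlowJumping g) (hp : Predictable g)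
    (ε : ℕ → ℝ) (hε : SubPoly ε) (hεb : ∀ x, 0 < ε x ∧ ε x < 1 / 2) :
    ∃ h : ℕ → ℝ, SubPoly h ∧
      ∀ x y : ℕ, rstab g (ε x) x + 1 ≤ y → (y : ℝ) < (x : ℝ) / h x →
        g x / h x ≤ g y := by
  let P : ℕ → ℕ → Prop := fun k x => 1 ≤ x → ∀ y : ℕ, rstab g (ε x) x + 1 ≤ y →
    (y : ℝ) < (x : ℝ) ^ (1 - (1 : ℝ) / ((k : ℝ) + 1)) →
    (x : ℝ) ^ (-((1 : ℝ) / ((k : ℝ) + 1))) * g x ≤ g y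
  have h0 : ∀ x, P 0 x := fun x _ y hy hyx => by
    simp at hyx
    omega
  have hev : ∀ k, ∀ᶠ x in atTop, P k x := fun k => by
    rcases Nat.eq_zero_or_pos k with rfl | hk
    · exact Eventually.of_forall h0
    have hk' : (0 : ℝ) < k := by exact_mod_cast hk
    filter_upwards [eventually_rpow_neg_mul_le hg hsd hsj hp hε hεb
      (γ := 1 / ((k : ℝ) + 1)) (by positivity)
      (by rw [div_lt_one (by positivity)]; linarith)] with x hx _
    exact hx
  obtain ⟨k, hk, hkP⟩ := exists_tendsto_atTop_forall h0 hev
  refine ⟨_, SubPoly.of_pos_rpow_inv hk, fun x y hy hyx => ?_⟩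
  rcases Nat.eq_zero_or_pos x with rfl | hx
  · simp only [Nat.cast_zero, zero_div] at hyx
    exact absurd hyx (not_lt.2 (Nat.cast_nonneg y))
  have hx0 : (0 : ℝ) < x := by exact_mod_cast hx
  have h := hkP x hx y hy (by rwa [Real.rpow_sub hx0, Real.rpow_one])
  rwa [Real.rpow_neg hx0.le, inv_mul_eq_div] at h

end
end

section
/- Let g ∈ 𝒢 be 𝕊-nearly periodic, with g(x) > 0 for all x > 0, and suppose g is bounded above by some sub-polynomial function. Then there exist α > 0 and a strictly increasing sequence (y_k) of positive integers such that g(y_k) ≤ y_k^{−α} for all k and, for every x ∈ ℕ, lim_{k→∞} g(x + y_k) = g(x). -/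
open Filter Real
open scoped ENNReal

noncomputable section

theorem inv_log_mem_SFuns : (fun x : ℕ => (Real.log ((x : ℝ) + 2))⁻¹) ∈ SFuns := by
  have hpos : ∀ x : ℕ, 0 < Real.log ((x : ℝ) + 2) := fun x =>
    Real.log_pos (by have : (0 : ℝ) ≤ x := x.cast_nonneg; linarith)
  have hlog : Tendsto (fun x : ℕ => (Real.log ((x : ℝ) + 2))⁻¹) atTop (nhds 0) :=
    tendsto_inv_atTop_zero.comp (Real.tendsto_log_atTop.comp
      (tendsto_atTop_add_const_right _ _ tendsto_natCast_atTop_atTop))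
  refine ⟨⟨fun x => (inv_pos.2 (hpos x)).le, fun α hα => ⟨?_, ?_⟩⟩, ?_⟩
  · have hα2 : 0 < α / 2 := half_pos hα
    have hc : 0 < α / 2 * ((3 : ℝ) ^ (α / 2))⁻¹ := by positivity
    refine tendsto_atTop_mono' _ ?_ (((tendsto_rpow_atTop hα2).comp
      tendsto_natCast_atTop_atTop).const_mul_atTop hc)
    filter_upwards [eventually_ge_atTop 1] with x hx
    have hx1 : (1 : ℝ) ≤ x := by exact_mod_cast hx
    have hx0 : (0 : ℝ) < x := by linarith
    have hle : Real.log ((x : ℝ) + 2) ≤ (3 : ℝ) ^ (α / 2) * (x : ℝ) ^ (α / 2) / (α / 2) := by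
      refine (Real.log_le_rpow_div (by positivity) hα2).trans ?_
      rw [← Real.mul_rpow (by norm_num) hx0.le]
      gcongr
      linarith
    have hsplit : (x : ℝ) ^ α = (x : ℝ) ^ (α / 2) * (x : ℝ) ^ (α / 2) := by
      rw [← Real.rpow_add hx0, add_halves]
    rw [le_mul_inv_iff₀ (hpos x), Function.comp_apply, hsplit]
    calc _ ≤ α / 2 * ((3 : ℝ) ^ (α / 2))⁻¹ * (x : ℝ) ^ (α / 2) *
          ((3 : ℝ) ^ (α / 2) * (x : ℝ) ^ (α / 2) / (α / 2)) := by gcongr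
      _ = _ := by
        have : (3 : ℝ) ^ (α / 2) ≠ 0 := by positivity
        field_simp
  · simpa using ((tendsto_rpow_neg_atTop hα).comp tendsto_natCast_atTop_atTop).mul hlog
  · intro x y hxy
    have := hpos x
    dsimp only
    gcongr

theorem SubPoly.eventually_forall_lt_le_rpow {f : ℕ → ℝ} (hf : SubPoly f) {β : ℝ} (hβ : 0 < β) :
    ∀ᶠ y : ℕ in atTop, ∀ x < y, f x ≤ (y : ℝ) ^ β := by
  have hsmall : ∀ᶠ x : ℕ in atTop, f x ≤ (x : ℝ) ^ β := by
    filter_upwards [(hf.2 β hβ).2.eventually_le_const one_pos, eventually_gt_atTop 0] with x hx hx0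
    have hx0 : (0 : ℝ) < x := by exact_mod_cast hx0
    rwa [Real.rpow_neg hx0.le, inv_mul_le_iff₀ (by positivity), mul_one] at hx
  obtain ⟨M, hM⟩ := eventually_atTop.1 hsmall
  have hinit : ∀ᶠ y : ℕ in atTop, ∀ x ∈ Finset.range M, f x ≤ (y : ℝ) ^ β :=
    (Finset.eventually_all _).2 fun x _ =>
      ((tendsto_rpow_atTop hβ).comp tendsto_natCast_atTop_atTop).eventually_ge_atTop (f x)
  filter_upwards [hinit] with y hy x hxy
  rcases lt_or_ge x M with h | h
  · exact hy x (Finset.mem_range.2 h)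
  · exact (hM x h).trans (by gcongr)

/-- a positive 𝕊-nearly periodic `g ∈ 𝒢` bounded above by a
sub-polynomial function admits `α > 0` and a strictly increasing sequence
`y k` with `g (y k) ≤ (y k)^(-α)` and `g (x + y k) → g x` for every `x`. -/
theorem strange_limits (g : ℕ → ℝ) (hg : InG g)
    (hnp : NearlyPeriodic SFuns g)
    (hbdd : ∃ f : ℕ → ℝ, SubPoly f ∧ ∀ x, g x ≤ f x) :
    ∃ α : ℝ, 0 < α ∧ ∃ y : ℕ → ℕ, StrictMono y ∧ (∀ k, 0 < y k) ∧
      (∀ k, g (y k) ≤ (y k : ℝ) ^ (-α)) ∧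
      ∀ x : ℕ, Tendsto (fun k => g (x + y k)) atTop (nhds (g x)) := by
  obtain ⟨⟨α, hα, hper⟩, hnear⟩ := hnp
  obtain ⟨f, hf, hgf⟩ := hbdd
  have hfreq : ∃ᶠ y : ℕ in atTop, 1 < y ∧ g y ≤ (y : ℝ) ^ (-(α / 2)) := by
    have hF : ∃ᶠ y : ℕ in atTop, IsPeriod g α y := by
      refine frequently_atTop.2 fun N => ?_
      obtain ⟨y, hy, h⟩ := hper (N + 1) N.succ_pos
      exact ⟨y, by omega, h⟩
    refine (hF.and_eventually ((hf.eventually_forall_lt_le_rpow (half_pos hα)).and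
      (eventually_gt_atTop 1))).mono ?_
    rintro y ⟨⟨x, hxy, hgy⟩, hle, hy⟩
    have hy0 : (0 : ℝ) < y := by exact_mod_cast one_pos.trans hy
    refine ⟨hy, hgy.trans ?_⟩
    calc g x / (y : ℝ) ^ α ≤ (y : ℝ) ^ (α / 2) / (y : ℝ) ^ α := by
          gcongr
          exact (hgf x).trans (hle x hxy)
      _ = (y : ℝ) ^ (-(α / 2)) := by
          rw [← Real.rpow_sub hy0]
          congr 1
          ring
  obtain ⟨y, hmono, hy⟩ := extraction_of_frequently_atTop hfreq
  refine ⟨α / 2, half_pos hα, y, hmono, fun k => one_pos.trans (hy k).1, fun k => (hy k).2, ?_⟩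
  have hyreal : Tendsto (fun k => (y k : ℝ)) atTop atTop :=
    tendsto_natCast_atTop_atTop.comp hmono.tendsto_atTop
  have hscaled : ∀ k, g (y k) * (y k : ℝ) ^ (α / 4) ≤ (y k : ℝ) ^ (-(α / 4)) := fun k => by
    have hy0 : (0 : ℝ) < y k := by exact_mod_cast one_pos.trans (hy k).1
    calc _ ≤ (y k : ℝ) ^ (-(α / 2)) * (y k : ℝ) ^ (α / 4) := by
          gcongr
          exact (hy k).2
      _ = _ := by
          rw [← Real.rpow_add hy0]
          congr 1
          ring
  have hdecay : Tendsto (fun k => (y k : ℝ) ^ (-(α / 4))) atTop (nhds 0) :=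
    (tendsto_rpow_neg_atTop (by positivity)).comp hyreal
  intro x
  rcases x.eq_zero_or_pos with rfl | hx
  · rw [hg.1]
    refine squeeze_zero (fun k => ?_) (fun k => ?_)
      ((tendsto_rpow_neg_atTop (half_pos hα)).comp hyreal)
    · rw [zero_add]
      exact (hg.2.2 _ (one_pos.trans (hy k).1)).le
    · rw [zero_add]
      exact (hy k).2
  · obtain ⟨N, -, hN⟩ := hnear (α / 4) (by positivity) _ inv_log_mem_SFuns
    have hlim : Tendsto (fun k => g x * (Real.log ((y k : ℝ) + 2))⁻¹) atTop (nhds 0) := by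
      simpa using (tendsto_inv_atTop_zero.comp (Real.tendsto_log_atTop.comp
        (tendsto_atTop_add_const_right _ 2 hyreal))).const_mul (g x)
    rw [tendsto_iff_dist_tendsto_zero]
    refine squeeze_zero' (Eventually.of_forall fun _ => dist_nonneg) ?_ hlim
    filter_upwards [hmono.tendsto_atTop.eventually_ge_atTop N,
      hmono.tendsto_atTop.eventually_gt_atTop x,
      hdecay.eventually_le_const (hg.2.2 x hx)] with k hkN hkx hkg
    have hy1 : (1 : ℝ) ≤ y k := by exact_mod_cast (hy k).1.le
    have hperiod : IsPeriod g (α / 4) (y k) := by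
      refine ⟨1, (hy k).1, ?_⟩
      rw [hg.2.1, le_div_iff₀ (by positivity)]
      exact (hscaled k).trans (Real.rpow_le_one_of_one_le_of_nonpos hy1 (by linarith))
    rw [Real.dist_eq]
    refine (hN (y k) hperiod hkN x hkx ((hscaled k).trans hkg)).trans ?_
    have : 0 ≤ (Real.log ((y k : ℝ) + 2))⁻¹ := inv_nonneg.2 (Real.log_nonneg (by linarith))
    gcongr
    exact min_le_left _ _

end
end

section
/- The function g_np, defined by g_np(0) = 0 and g_np(x) = 2^{−ν₂(x)} for x > 0 (where ν₂(x) is the 2-adic valuation of x), is 𝕊-nearly periodic. -/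
open Filter Real
open scoped ENNReal

noncomputable section

/-- The function `g_np` with `g_np 0 = 0` and `g_np x = 2^(-ν₂ x)` for `x > 0`. -/
def gnp : ℕ → ℝ := fun x => if x = 0 then 0 else (2 : ℝ) ^ (-(padicValNat 2 x : ℤ))

theorem gnp_of_pos {x : ℕ} (hx : 0 < x) :
    gnp x = (2 : ℝ) ^ (-(padicValNat 2 x : ℤ)) :=
  if_neg hx.ne'

theorem gnp_nonneg (x : ℕ) : 0 ≤ gnp x := by
  unfold gnp
  split_ifs <;> positivity

theorem gnp_two_pow (n : ℕ) : gnp (2 ^ n) = ((2 : ℝ) ^ n)⁻¹ := by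
  rw [gnp_of_pos (by positivity), padicValNat.prime_pow, zpow_neg, zpow_natCast]

theorem gnp_one : gnp 1 = 1 := by
  simpa using gnp_two_pow 0

/-- Adding a number of larger 2-adic valuation does not change `gnp`. -/
theorem gnp_add_eq_of_lt {x y : ℕ} (hy : 0 < y) (h : gnp y < gnp x) :
    gnp (x + y) = gnp x := by
  have hx : 0 < x := by
    rcases Nat.eq_zero_or_pos x with rfl | hx
    · exact absurd h (not_lt.mpr (by simpa [gnp] using gnp_nonneg y))
    · exact hx
  have hval : padicValNat 2 x < padicValNat 2 y := by
    rw [gnp_of_pos hx, gnp_of_pos hy, zpow_lt_zpow_iff_right₀ one_lt_two] at h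
    omega
  have hadd : padicValNat 2 (x + y) = padicValNat 2 x := by
    have := padicValRat.add_eq_of_lt (p := 2) (q := x) (r := y)
      (by positivity) (by positivity) (by positivity) (by simpa using hval)
    rw [← Nat.cast_add] at this
    simpa only [padicValRat.of_nat, Nat.cast_inj] using this
  rw [gnp_of_pos hx, gnp_of_pos (by omega), hadd]

/-- `g_np` is 𝕊-nearly periodic. -/
theorem gnp_nearlyPeriodic : NearlyPeriodic SFuns gnp := by
  refine ⟨⟨1, one_pos, fun N hN => ⟨2 ^ N, Nat.lt_two_pow_self.le, 1,
    Nat.one_lt_two_pow hN.ne', ?_⟩⟩, fun α hα h hh => ⟨2, two_pos, ?_⟩⟩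
  · simp [gnp_two_pow, gnp_one]
  · intro y _ hy x _ hxy
    have hgy : 0 < gnp y := by
      rw [gnp_of_pos (by omega)]
      positivity
    have hpow : 1 < (y : ℝ) ^ α := Real.one_lt_rpow (by exact_mod_cast hy) hα
    have hlt : gnp y < gnp x := (lt_mul_of_one_lt_right hgy hpow).trans_le hxy
    rw [gnp_add_eq_of_lt (by omega) hlt, sub_self, abs_zero, min_self]
    exact mul_nonneg (gnp_nonneg x) (hh.1.1 y)

end
end

section
/- If g ∈ 𝒢 is predictable, then for every η > 0 the function L_η(g) defined by L_η(g)(x) = g(x)·(log(1+x))^η is predictable. -/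
open Filter Real
open scoped ENNReal

noncomputable section

/-- Scaling a sub-polynomial function by a positive constant keeps it sub-polynomial. -/
lemma SubPoly.const_mul {f : ℕ → ℝ} (hf : SubPoly f) {c : ℝ} (hc : 0 < c) :
    SubPoly (fun x => c * f x) := by
  refine ⟨fun x => mul_nonneg hc.le (hf.1 x), fun α hα => ⟨?_, ?_⟩⟩
  · refine ((hf.2 α hα).1.const_mul_atTop hc).congr fun x => ?_
    ring
  · have h := ((hf.2 α hα).2).const_mul c
    rw [mul_zero] at h
    refine h.congr fun x => ?_
    ring

/-- Powers of `log (1 + x)` are eventually below any constant multiple of a positive power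
of `x`. -/
lemma eventually_log_one_add_rpow_le {η s c : ℝ} (hs : 0 < s) (hc : 0 < c) :
    ∀ᶠ x : ℕ in atTop, log (1 + (x : ℝ)) ^ η ≤ c * (x : ℝ) ^ s := by
  have h2 : (0 : ℝ) < 2 ^ s := by positivity
  have hu : Tendsto (fun x : ℕ => 1 + (x : ℝ)) atTop atTop :=
    tendsto_atTop_add_const_left _ _ tendsto_natCast_atTop_atTop
  have h := hu.eventually ((isLittleO_log_rpow_rpow_atTop η hs).bound (div_pos hc h2))
  filter_upwards [h, eventually_ge_atTop 1] with x hx hx1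
  have hx1' : (1 : ℝ) ≤ x := by exact_mod_cast hx1
  have hpow : (1 + (x : ℝ)) ^ s ≤ 2 ^ s * (x : ℝ) ^ s := by
    rw [← mul_rpow (by norm_num) (by linarith)]
    exact rpow_le_rpow (by linarith) (by linarith) hs.le
  rw [norm_of_nonneg (rpow_nonneg (by linarith : (0 : ℝ) ≤ 1 + x) s)] at hx
  calc log (1 + (x : ℝ)) ^ η ≤ c / 2 ^ s * (1 + (x : ℝ)) ^ s := (le_abs_self _).trans hx
    _ ≤ c / 2 ^ s * (2 ^ s * (x : ℝ) ^ s) := by gcongr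
    _ = c * (x : ℝ) ^ s := by field_simp

/-- If `y ≤ t * x` with `η * t ≤ 1`, then `log (1 + x + y) ^ η` exceeds `log (1 + x) ^ η` by a
factor of at most `1 + 2 * η * t`. -/
lemma log_one_add_add_rpow_le {η t x y : ℝ} (hη : 0 < η) (hx : 0 ≤ x) (hlog : 1 ≤ log (1 + x))
    (ht : 0 ≤ t) (hηt : η * t ≤ 1) (hy : 0 ≤ y) (hyt : y ≤ t * x) :
    log (1 + (x + y)) ^ η ≤ log (1 + x) ^ η * (1 + 2 * (η * t)) := by
  have hsplit : log (1 + (x + y)) ≤ log (1 + x) + t := by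
    have hle : 1 + (x + y) ≤ (1 + x) * (1 + t) := by nlinarith
    calc log (1 + (x + y)) ≤ log ((1 + x) * (1 + t)) := log_le_log (by linarith) hle
      _ = log (1 + x) + log (1 + t) := log_mul (by linarith) (by linarith)
      _ ≤ log (1 + x) + t := by linarith [log_le_sub_one_of_pos (by linarith : 0 < 1 + t)]
  have hexp : log (1 + (x + y)) ≤ log (1 + x) * exp t := by
    nlinarith [add_one_le_exp t]
  have hpos : 0 ≤ log (1 + (x + y)) := log_nonneg (by linarith)
  calc log (1 + (x + y)) ^ η ≤ (log (1 + x) * exp t) ^ η := rpow_le_rpow hpos hexp hη.le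
    _ = log (1 + x) ^ η * exp (η * t) := by
      rw [mul_rpow (by linarith) (exp_pos t).le, ← exp_mul, mul_comm t]
    _ ≤ log (1 + x) ^ η * (1 + 2 * (η * t)) := by
      have hnn : 0 ≤ η * t := by positivity
      have h := abs_exp_sub_one_le (x := η * t) (by rwa [abs_of_nonneg hnn])
      rw [abs_of_nonneg hnn] at h
      have h' := (le_abs_self _).trans h
      have : 0 ≤ log (1 + x) ^ η := rpow_nonneg (by linarith) η
      gcongr
      linarith

/-- A multiplicative perturbation `A` to `B` with `A ≤ B ≤ (1 + d) * A` costs a constant factor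
in the relative error. -/
lemma abs_mul_sub_mul_le {u v A B d ε : ℝ} (hu : 0 ≤ u) (hA : 0 ≤ A) (hAB : A ≤ B)
    (hB : B ≤ A * (1 + d)) (hd1 : d ≤ 1) (hd : d ≤ ε / 2) (h : |v - u| ≤ 1 / 4 * ε * u) :
    |v * B - u * A| ≤ ε * (u * A) := by
  have hB2 : B ≤ 2 * A := by nlinarith
  have hdiff : B - A ≤ ε / 2 * A := by nlinarith
  have hB0 : 0 ≤ B := hA.trans hAB
  calc |v * B - u * A| = |(v - u) * B + u * (B - A)| := by ring_nf
    _ ≤ |v - u| * B + u * (B - A) := by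
      refine (abs_add_le _ _).trans_eq ?_
      rw [abs_mul, abs_mul, abs_of_nonneg hB0, abs_of_nonneg hu, abs_of_nonneg (sub_nonneg.2 hAB)]
    _ ≤ (1 / 4 * ε * u) * (2 * A) + u * (ε / 2 * A) :=
      add_le_add (mul_le_mul h hB2 hB0 ((abs_nonneg _).trans h))
        (mul_le_mul_of_nonneg_left hdiff hu)
    _ = ε * (u * A) := by ring

/-- predictability is preserved by the transformation
`L_η(g)(x) = g x * (log (1+x))^η` for every `η > 0`. -/
theorem predictable_Leta (g : ℕ → ℝ) (hg : InG g) (hp : Predictable g)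
    (η : ℝ) (hη : 0 < η) :
    Predictable (fun x : ℕ => g x * Real.log (1 + (x : ℝ)) ^ η) := by
  intro γ hγ hγ1 ε hε
  obtain ⟨N, hN⟩ := hp (γ / 2) (by linarith) (by linarith) _ (hε.const_mul (c := 1 / 4) (by norm_num))
  have hlog2 : 0 < log 2 ^ η := rpow_pos_of_pos (log_pos (by norm_num)) η
  have hsmall : ∀ᶠ x : ℕ in atTop, (x : ℝ) ^ (-γ) ≤ 1 / (2 * η) :=
    ((tendsto_rpow_neg_atTop hγ).comp tendsto_natCast_atTop_atTop).eventually_le_const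
      (by positivity)
  have hlog : ∀ᶠ x : ℕ in atTop, 1 ≤ log (1 + (x : ℝ)) :=
    (tendsto_log_atTop.comp (tendsto_atTop_add_const_left _ 1
      tendsto_natCast_atTop_atTop)).eventually_ge_atTop 1
  obtain ⟨M, hM⟩ := eventually_atTop.1 <| (eventually_ge_atTop N).and <|
    (eventually_ge_atTop 1).and <| hsmall.and <| hlog.and <|
    ((hε.2 γ hγ).1.eventually_ge_atTop (4 * η)).and <|
    eventually_log_one_add_rpow_le (η := η) (half_pos hγ) hlog2
  refine ⟨M, fun x hx y hy hyx hmem => ?_⟩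
  obtain ⟨hxN, hx1, ht, hlogx, hεx, hbig⟩ := hM x hx
  have hx1' : (1 : ℝ) ≤ x := by exact_mod_cast hx1
  have hx0 : (0 : ℝ) < x := by linarith
  have hy1 : (1 : ℝ) ≤ y := by exact_mod_cast hy
  have htpos : 0 < (x : ℝ) ^ (-γ) := rpow_pos_of_pos hx0 _
  have hηt : 2 * (η * (x : ℝ) ^ (-γ)) ≤ 1 := by
    rw [le_div_iff₀ (by positivity)] at ht
    linarith
  have hηε : 2 * (η * (x : ℝ) ^ (-γ)) ≤ ε x / 2 := by
    rw [rpow_neg hx0.le, ← div_eq_mul_inv, ← mul_div_assoc, div_le_iff₀ (rpow_pos_of_pos hx0 _)]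
    linarith
  have hyt : (y : ℝ) ≤ (x : ℝ) ^ (-γ) * x := by
    rw [← rpow_add_one hx0.ne', neg_add_eq_sub]
    exact hyx.le
  have hgx := hg.2.2 x hx1
  have hA : 0 ≤ log (1 + (x : ℝ)) ^ η := rpow_nonneg (by linarith) η
  have hgy : (x : ℝ) ^ (-(γ / 2)) * g x ≤ g y := by
    refine hN x hxN y hy (hyx.trans_le (rpow_le_rpow_of_exponent_le hx1' (by linarith)))
      fun hclose => hmem ?_
    refine abs_mul_sub_mul_le hgx.le hA ?_ ?_ hηt hηε hclose
    · push_cast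
      exact rpow_le_rpow (by linarith) (log_le_log (by linarith) (by linarith)) hη.le
    · push_cast
      exact log_one_add_add_rpow_le hη hx0.le hlogx htpos.le (by nlinarith) (by linarith) hyt
  have hℓy : log 2 ^ η ≤ log (1 + (y : ℝ)) ^ η :=
    rpow_le_rpow (log_nonneg (by norm_num)) (log_le_log (by norm_num) (by linarith)) hη.le
  calc (x : ℝ) ^ (-γ) * (g x * log (1 + (x : ℝ)) ^ η)
      ≤ (x : ℝ) ^ (-γ) * (g x * (log 2 ^ η * (x : ℝ) ^ (γ / 2))) := by gcongr
    _ = (x : ℝ) ^ (-γ) * (x : ℝ) ^ (γ / 2) * g x * log 2 ^ η := by ring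
    _ = (x : ℝ) ^ (-(γ / 2)) * g x * log 2 ^ η := by
      rw [← rpow_add hx0]
      ring_nf
    _ ≤ g y * log (1 + (y : ℝ)) ^ η :=
      mul_le_mul hgy hℓy hlog2.le (hg.2.2 y hy).le

end
end

section
/- If g ∈ 𝒢 is 𝕊-nearly periodic, then for every δ > 0 there exists h ∈ 𝒢 with Θ(g,h) ≤ δ such that h is not slow-dropping and h is 𝕊-normal (i.e., not 𝕊-nearly periodic). -/
open Filter Real
open scoped ENNReal

noncomputable section

/-- Alternating colour along the chains of a predecessor map `f`. -/
def chainColor (f : ℕ → ℕ) (n : ℕ) : Bool :=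
  if f n < n then !chainColor f (f n) else false
termination_by n

theorem chainColor_of_lt {f : ℕ → ℕ} {n : ℕ} (h : f n < n) :
    chainColor f n = !chainColor f (f n) := by
  rw [chainColor, if_pos h]

theorem chainColor_of_fixed {f : ℕ → ℕ} {n : ℕ} (h : f n = n) : chainColor f n = false := by
  rw [chainColor, if_neg (by omega)]

/-- A 2-colouring of `ℕ` separating each `x k` from its translate `x k + y k`,
for a lacunary sequence `y`. -/
theorem exists_separating_coloring {x y : ℕ → ℕ} (hx : ∀ k, 0 < x k) (hxy : ∀ k, x k < y k)
    (hy : ∀ j k, j < k → 2 * y j < y k) :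
    ∃ s : ℕ → Bool, (∀ k, s (x k + y k) = !s (x k)) ∧ (∀ k, s (y k) = false) ∧ s 1 = false := by
  classical
  let f : ℕ → ℕ := fun n => if h : ∃ k, x k + y k = n then x h.choose else n
  have hinj : ∀ j k, x j + y j = x k + y k → j = k := by
    intro j k h
    have := hxy j
    have := hxy k
    rcases lt_trichotomy j k with hjk | hjk | hjk
    · have := hy j k hjk
      omega
    · exact hjk
    · have := hy k j hjk
      omega
  have hf : ∀ k, f (x k + y k) = x k := by
    intro k
    have h : ∃ j, x j + y j = x k + y k := ⟨k, rfl⟩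
    simp only [f, dif_pos h]
    rw [hinj _ _ h.choose_spec]
  have hf' : ∀ n, (∀ k, x k + y k ≠ n) → f n = n := by
    intro n h
    simp only [f]
    exact dif_neg (by simpa using h)
  refine ⟨chainColor f, fun k => ?_, fun k => chainColor_of_fixed (hf' _ fun j h => ?_),
    chainColor_of_fixed (hf' _ fun j h => ?_)⟩
  · have h : f (x k + y k) < x k + y k := by
      have := hxy k
      rw [hf]
      omega
    rw [chainColor_of_lt h, hf]
  · have := hx j
    have := hxy j
    rcases lt_trichotomy j k with hjk | rfl | hjk
    · have := hy j k hjk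
      omega
    · omega
    · have := hy k j hjk
      omega
  · have := hx j
    have := hxy j
    omega

theorem exists_lacunary_seq {P : ℕ → Prop} (h : ∀ N, ∃ y, N ≤ y ∧ P y) :
    ∃ y : ℕ → ℕ, (∀ k, P (y k)) ∧ (∀ k, k < y k) ∧ ∀ j k, j < k → 2 * y j < y k := by
  choose F hF hP using h
  let y : ℕ → ℕ := fun k => Nat.rec (F 1) (fun _ m => F (2 * m + 1)) k
  have h0 : y 0 = F 1 := rfl
  have hs : ∀ k, y (k + 1) = F (2 * y k + 1) := fun _ => rfl
  have hlt : ∀ k, 2 * y k < y (k + 1) := fun k => by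
    have := hF (2 * y k + 1)
    rw [hs]
    omega
  have hmono : Monotone y := monotone_nat_of_le_succ fun k => by
    have := hlt k
    omega
  refine ⟨y, fun k => ?_, fun k => ?_, fun j k hjk => (hlt j).trans_le (hmono hjk)⟩
  · cases k with
    | zero => exact hP 1
    | succ k => exact hP _
  · induction k with
    | zero => exact hF 1
    | succ k ih =>
      have := hlt k
      omega

theorem const_mem_SFuns {ε : ℝ} (hε : 0 < ε) : (fun _ : ℕ => ε) ∈ SFuns := by
  refine ⟨⟨fun _ => hε.le, fun α hα => ⟨?_, ?_⟩⟩, antitone_const⟩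
  · exact ((tendsto_rpow_atTop hα).comp tendsto_natCast_atTop_atTop).atTop_mul_const hε
  · simpa using ((tendsto_rpow_neg_atTop hα).comp tendsto_natCast_atTop_atTop).mul_const ε

theorem le_mul_of_abs_sub_le_min {a b ε : ℝ} (hε : 0 ≤ ε) (h : |b - a| ≤ min a b * ε) :
    a ≤ b * (1 + ε) ∧ b ≤ a * (1 + ε) := by
  have h1 := abs_le.1 h
  have h2 := mul_le_mul_of_nonneg_right (min_le_left a b) hε
  have h3 := mul_le_mul_of_nonneg_right (min_le_right a b) hε
  constructor <;> linarith

/-- A function with arbitrarily large `α`-periods is not slow-dropping. -/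
theorem not_slowDropping_of_periods {g : ℕ → ℝ} (hg : InG g) {α : ℝ} (hα : 0 < α)
    (h : ∀ N : ℕ, ∃ y, N ≤ y ∧ IsPeriod g α y) : ¬ SlowDropping g := by
  intro hs
  obtain ⟨N, -, hN⟩ := hs (α / 2) (by linarith)
  obtain ⟨y, hy, x, hxy, hgx⟩ := h (N + 2)
  have h1 := hN x y hxy (by omega)
  have hy1 : (1 : ℝ) < y := by exact_mod_cast (by omega : 1 < y)
  have hgy := hg.2.2 y (by omega)
  have hpos : 0 < (y : ℝ) ^ α := by positivity
  have hgx0 : 0 < g x := by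
    by_contra hle
    have := div_nonpos_of_nonpos_of_nonneg (not_lt.1 hle) hpos.le
    linarith
  have h2 : (y : ℝ) ^ (α / 2) < (y : ℝ) ^ α := rpow_lt_rpow_of_exponent_lt hy1 (by linarith)
  have h3 := div_lt_div_of_pos_left hgx0 (by positivity) h2
  linarith

/-- every 𝕊-nearly periodic `g ∈ 𝒢` is within distance `δ` of a
function `h ∈ 𝒢` that is not slow-dropping and is 𝕊-normal. -/
theorem nearlyPeriodic_unstable (g : ℕ → ℝ) (hg : InG g)
    (hnp : NearlyPeriodic SFuns g) (δ : ℝ) (hδ : 0 < δ) :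
    ∃ h : ℕ → ℝ, InG h ∧ Theta g h ≤ ENNReal.ofReal δ ∧
      ¬ SlowDropping h ∧ ¬ NearlyPeriodic SFuns h := by
  obtain ⟨⟨α, hα, hper⟩, hnear⟩ := hnp
  obtain ⟨y, hyP, hky, hy⟩ := exists_lacunary_seq (P := IsPeriod g α) fun N => by
    obtain ⟨y, h1, h2⟩ := hper (N + 1) N.succ_pos
    exact ⟨y, by omega, h2⟩
  choose x hxy hgxy using hyP
  have hypow : ∀ k, 0 < (y k : ℝ) ^ α := fun k =>
    rpow_pos_of_pos (by exact_mod_cast (Nat.zero_le k).trans_lt (hky k)) α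
  have hx : ∀ k, 0 < x k := by
    intro k
    by_contra h0
    have h1 := hgxy k
    have h2 := hg.2.2 (y k) ((Nat.zero_le k).trans_lt (hky k))
    rw [show x k = 0 by omega, hg.1, zero_div] at h1
    linarith
  obtain ⟨s, hs, hsy, hs1⟩ := exists_separating_coloring hx hxy hy
  let c : ℕ → ℝ := fun n => if s n then exp δ else 1
  have hc1 : ∀ n, 1 ≤ c n := fun n => by
    have := one_le_exp hδ.le
    by_cases h : s n <;> simp [c, h, this]
  have hcpos : ∀ n, 0 < c n := fun n => one_pos.trans_le (hc1 n)
  let h : ℕ → ℝ := fun n => g n * c n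
  have hG : InG h :=
    ⟨by simp [h, hg.1], by simp [h, c, hs1, hg.2.1], fun n hn => mul_pos (hg.2.2 n hn) (hcpos n)⟩
  have hhxy : ∀ k, h (y k) ≤ h (x k) / (y k : ℝ) ^ α := by
    intro k
    have h1 : h (y k) = g (y k) := by simp [h, c, hsy]
    rw [h1]
    refine (hgxy k).trans (div_le_div_of_nonneg_right ?_ (hypow k).le)
    exact le_mul_of_one_le_right (hg.2.2 _ (hx k)).le (hc1 _)
  refine ⟨h, hG, ?_, not_slowDropping_of_periods hG hα fun N =>
    ⟨y N, (hky N).le, x N, hxy N, hhxy N⟩, ?_⟩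
  · refine iSup₂_le fun n hn => ENNReal.ofReal_le_ofReal ?_
    rw [log_mul (hg.2.2 n hn).ne' (hcpos n).ne', sub_add_cancel_left, abs_neg]
    by_cases hn' : s n <;> simp [c, hn', abs_of_pos hδ, hδ.le]
  · rintro ⟨-, hh⟩
    have hε : 0 < exp (δ / 4) - 1 := sub_pos.2 (one_lt_exp_iff.2 (by linarith))
    obtain ⟨N₁, -, h₁⟩ := hnear α hα _ (const_mem_SFuns hε)
    obtain ⟨N₂, -, h₂⟩ := hh α hα _ (const_mem_SFuns hε)
    obtain ⟨k, hk⟩ : ∃ k, k = max N₁ N₂ := ⟨_, rfl⟩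
    have hkN := hky k
    have hg' := le_mul_of_abs_sub_le_min hε.le <|
      h₁ (y k) ⟨x k, hxy k, hgxy k⟩ (by omega) (x k) (hxy k) ((le_div_iff₀ (hypow k)).1 (hgxy k))
    have hh' := le_mul_of_abs_sub_le_min hε.le <|
      h₂ (y k) ⟨x k, hxy k, hhxy k⟩ (by omega) (x k) (hxy k)
        ((le_div_iff₀ (hypow k)).1 (hhxy k))
    rw [add_sub_cancel] at hg' hh'
    have key : ∀ a b : ℝ, 0 < b → a ≤ b * exp (δ / 4) → b * exp δ ≤ a * exp (δ / 4) → False := by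
      intro a b hb h1 h2
      have h3 : b * exp δ ≤ b * exp (δ / 2) := by
        calc b * exp δ ≤ a * exp (δ / 4) := h2
          _ ≤ b * exp (δ / 4) * exp (δ / 4) := by gcongr
          _ = b * exp (δ / 2) := by rw [mul_assoc, ← exp_add]; ring_nf
      have h4 := exp_le_exp.1 (le_of_mul_le_mul_left h3 hb)
      linarith
    have hga := hg.2.2 _ (hx k)
    have hgb := hg.2.2 (x k + y k) (Nat.add_pos_left (hx k) _)
    have hsk := hs k
    cases hsx : s (x k)
    · have e1 : h (x k) = g (x k) := by simp [h, c, hsx]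
      have e2 : h (x k + y k) = g (x k + y k) * exp δ := by simp [h, c, hsk, hsx]
      rw [e1, e2] at hh'
      exact key _ _ hgb hg'.1 hh'.2
    · have e1 : h (x k) = g (x k) * exp δ := by simp [h, c, hsx]
      have e2 : h (x k + y k) = g (x k + y k) := by simp [h, c, hsk, hsx]
      rw [e1, e2] at hh'
      exact key _ _ hga hg'.2 hh'.1

end
end

section
/- Let M be a positive integer, S ⊆ {1,…,M}, and j ∈ {1,…,M}. Then there exists a set W of ordered pairs of the form (i, |i−j|) with i ∈ S, such that |W| ≥ |S|/4 − 1 and all the numbers appearing as coordinates of pairs in W are pairwise distinct (in particular, W is a matching: every pair (i, |i−j|) ∈ W has i ≠ |i−j|, and no two pairs in W share any coordinate value). -/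
open Filter Real
open scoped ENNReal

noncomputable section

/-- The classes `0`, `1`, `2` for which indices of equal class give disjoint pairs `(i, |i - j|)`:
the odd and the even values of `i / j`, where the even class omits `j / 2 < i < j`. -/
def indexClass (j i : ℕ) : ℕ :=
  if i / j % 2 = 1 then 1 else if i < j ∧ j < 2 * i then 2 else 0

theorem ne_dist_of_two_mul_ne {j i : ℕ} (hj : 0 < j) (h : 2 * i ≠ j) : i ≠ Nat.dist i j := by
  unfold Nat.dist
  omega

theorem ne_dist_of_indexClass_eq {j i k : ℕ} (hj : 0 < j) (hi : 2 * i ≠ j)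
    (hik : i ≠ k) (h : indexClass j i = indexClass j k) : i ≠ Nat.dist k j := by
  intro e
  have hc : k = i + j ∨ k + i = j := by unfold Nat.dist at e; omega
  unfold indexClass at h
  rcases hc with rfl | hc
  · rw [Nat.add_div_right _ hj] at h
    split_ifs at h <;> omega
  · rcases Nat.eq_zero_or_pos k with rfl | hk
    · have : i = j := by omega
      subst this
      simp [Nat.div_self hj] at h
    rcases Nat.eq_zero_or_pos i with rfl | hi'
    · have : k = j := by omega
      subst this
      simp [Nat.div_self hj] at h
    rw [Nat.div_eq_of_lt (show i < j by omega), Nat.div_eq_of_lt (show k < j by omega)] at h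
    split_ifs at h <;> omega

theorem dist_ne_dist_of_indexClass_eq {j i k : ℕ} (hi : 0 < i) (hk : 0 < k)
    (hik : i ≠ k) (h : indexClass j i = indexClass j k) : Nat.dist i j ≠ Nat.dist k j := by
  wlog hlt : i < k generalizing i k
  · exact (this hk hi hik.symm h.symm (by omega)).symm
  intro e
  have hc : i + k = 2 * j := by unfold Nat.dist at e; omega
  unfold indexClass at h
  have hk1 : k / j = 1 := Nat.div_eq_of_lt_le (by omega) (by omega)
  rw [Nat.div_eq_of_lt (show i < j by omega), hk1] at h
  split_ifs at h <;> omega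

theorem exists_indexClass_filter_card (j : ℕ) (S : Finset ℕ) :
    ∃ c, S.card ≤ 3 * (S.filter fun i => 2 * i ≠ j ∧ indexClass j i = c).card + 1 := by
  set T := S.filter fun i => 2 * i ≠ j with hT
  have hST : S.card ≤ T.card + 1 := by
    have hsub : S ⊆ insert (j / 2) T := by
      intro i hi
      by_cases h : 2 * i = j
      · exact Finset.mem_insert.2 (Or.inl (by omega))
      · exact Finset.mem_insert_of_mem (Finset.mem_filter.2 ⟨hi, h⟩)
    exact (Finset.card_le_card hsub).trans (Finset.card_insert_le _ _)
  have hmap : ∀ i ∈ T, indexClass j i ∈ Finset.range 3 := by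
    intro i _
    unfold indexClass
    split_ifs <;> simp
  have hsum := Finset.card_eq_sum_card_fiberwise hmap
  simp only [Finset.sum_range_succ, Finset.sum_range_zero, hT, Finset.filter_filter] at hsum
  rw [hT] at hST
  by_contra! hc
  have h0 := hc 0
  have h1 := hc 1
  have h2 := hc 2
  omega

/-- matching lemma: for `S ⊆ {1,…,M}` and `j ∈ {1,…,M}` there is
a set `W` of pairs `(i, |i−j|)` with `i ∈ S`, of size at least `|S|/4 − 1`,
whose coordinate values are pairwise distinct. -/
theorem big_index_subset (M : ℕ) (hM : 0 < M) (S : Finset ℕ)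
    (hS : S ⊆ Finset.Icc 1 M) (j : ℕ) (hj : j ∈ Finset.Icc 1 M) :
    ∃ W : Finset (ℕ × ℕ),
      (∀ p ∈ W, p.1 ∈ S ∧ p.2 = Nat.dist p.1 j) ∧
      (S.card : ℝ) / 4 - 1 ≤ (W.card : ℝ) ∧
      (∀ p ∈ W, p.1 ≠ p.2) ∧
      (∀ p ∈ W, ∀ q ∈ W, p ≠ q →
        p.1 ≠ q.1 ∧ p.1 ≠ q.2 ∧ p.2 ≠ q.1 ∧ p.2 ≠ q.2) := by
  have hj0 : 0 < j := (Finset.mem_Icc.1 hj).1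
  obtain ⟨c, hc⟩ := exists_indexClass_filter_card j S
  set T := S.filter fun i => 2 * i ≠ j ∧ indexClass j i = c with hT
  have hmem : ∀ i ∈ T, i ∈ S ∧ 0 < i ∧ 2 * i ≠ j ∧ indexClass j i = c := fun i hi => by
    obtain ⟨hiS, hi⟩ := Finset.mem_filter.1 hi
    exact ⟨hiS, (Finset.mem_Icc.1 (hS hiS)).1, hi⟩
  refine ⟨T.image fun i => (i, Nat.dist i j), ?_, ?_, ?_, ?_⟩
  · rw [Finset.forall_mem_image]
    exact fun i hi => ⟨(hmem i hi).1, rfl⟩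
  · rw [Finset.card_image_of_injective _ fun a b h => (Prod.mk.inj h).1]
    have : (S.card : ℝ) ≤ 3 * T.card + 1 := by exact_mod_cast hc
    have : (0 : ℝ) ≤ T.card := Nat.cast_nonneg _
    linarith
  · simp only [Finset.forall_mem_image]
    exact fun i hi => ne_dist_of_two_mul_ne hj0 (hmem i hi).2.2.1
  · simp only [Finset.forall_mem_image]
    intro i hi k hk hne
    have hik : i ≠ k := fun h => hne (by rw [h])
    obtain ⟨-, hi0, hi2, hic⟩ := hmem i hi
    obtain ⟨-, hk0, hk2, hkc⟩ := hmem k hk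
    have h := hic.trans hkc.symm
    exact ⟨hik, ne_dist_of_indexClass_eq hj0 hi2 hik h,
      (ne_dist_of_indexClass_eq hj0 hk2 hik.symm h.symm).symm,
      dist_ne_dist_of_indexClass_eq hi0 hk0 hik h⟩

end
end
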